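/- arXiv:0909.3169 — 10 statements merged into one kernel-verified Lean document; each statement's English description precedes it below -/
import Mathlib

section
/- Let X be a set with a distance function d : X × X → ℝ≥0, let 0 < λ ≤ 1, and suppose there exist points p, q, s ∈ X with d(p,s) + d(s,q) < λ·d(p,q) (so d violates the λ-relaxed triangle inequality). Then for any metric space (Y,ρ), any map f : X → Y, and any constants r > 0 and D ≥ 1 satisfying r·d(x,y) ≤ ρ(f(x),f(y)) ≤ D·r·d(x,y) for all x,y ∈ X, we must have D > 1/λ. -/
/-- If a distance function `d` on `X` violates the `λ`-relaxed triangle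
inequality at some triple `p, s, q` (i.e. `d p s + d s q < λ · d p q`), then any
embedding `f` of `(X, d)` into a metric space `(Y, ρ)` with constants `r > 0`, `D ≥ 1`
satisfying `r·d x y ≤ ρ (f x) (f y) ≤ D·r·d x y` for all `x, y` must have `D > 1/λ`. -/
theorem relaxed_triangle_lower_bound
    {X : Type*} (d : X → X → ℝ) (hd0 : ∀ x y, 0 ≤ d x y)
    (lam : ℝ) (hlam : 0 < lam) (hlam1 : lam ≤ 1)
    (p q s : X) (hviol : d p s + d s q < lam * d p q)
    {Y : Type*} [MetricSpace Y] (f : X → Y)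
    (r D : ℝ) (hr : 0 < r) (hD : 1 ≤ D)
    (hemb : ∀ x y, r * d x y ≤ dist (f x) (f y) ∧
      dist (f x) (f y) ≤ D * r * d x y) :
    1 / lam < D := by
  have hDr : 0 < D * r := mul_pos (by linarith) hr
  have hlt : r * d p q < (D * lam) * (r * d p q) :=
    calc r * d p q ≤ dist (f p) (f q) := (hemb p q).1
      _ ≤ dist (f p) (f s) + dist (f s) (f q) := dist_triangle _ _ _
      _ ≤ D * r * d p s + D * r * d s q := add_le_add (hemb p s).2 (hemb s q).2
      _ = D * r * (d p s + d s q) := by ring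
      _ < D * r * (lam * d p q) := mul_lt_mul_of_pos_left hviol hDr
      _ = (D * lam) * (r * d p q) := by ring
  rw [div_lt_iff₀ hlam]
  exact lt_of_mul_lt_mul_right (by rwa [one_mul]) (mul_nonneg hr.le (hd0 p q))
end

section
/- Let X be a set with a distance function d : X × X → ℝ≥0 and suppose there exist points p, q, s ∈ X with d(p,s) + d(s,q) < λ·d(p,q) for some 0 < λ ≤ 1. Let (Y,ρ) be a space whose distance function ρ satisfies the λ'-relaxed triangle inequality for some 0 < λ' ≤ 1, i.e. ρ(a,c) + ρ(c,b) ≥ λ'·ρ(a,b) for all a,b,c ∈ Y. Then any map f : X → Y with constants r > 0 and D ≥ 1 satisfying r·d(x,y) ≤ ρ(f(x),f(y)) ≤ D·r·d(x,y) for all x,y ∈ X must have D > λ'/λ. -/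
/-- If a distance function `d` on `X` violates the `λ`-relaxed triangle
inequality at some triple `p, s, q`, and `(Y, ρ)` is a space whose distance function
`ρ` satisfies the `λ'`-relaxed triangle inequality, then any map `f : X → Y` with
constants `r > 0`, `D ≥ 1` satisfying `r·d x y ≤ ρ (f x) (f y) ≤ D·r·d x y` for all
`x, y` must have `D > λ'/λ`. -/
theorem relaxed_triangle_lower_bound_relaxed_target
    {X : Type*} (d : X → X → ℝ) (hd0 : ∀ x y, 0 ≤ d x y)
    (lam : ℝ) (hlam : 0 < lam) (hlam1 : lam ≤ 1)
    (p q s : X) (hviol : d p s + d s q < lam * d p q)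
    {Y : Type*} (ρ : Y → Y → ℝ) (hρ0 : ∀ a b, 0 ≤ ρ a b)
    (lam' : ℝ) (hlam' : 0 < lam') (hlam'1 : lam' ≤ 1)
    (hρtri : ∀ a b c, lam' * ρ a b ≤ ρ a c + ρ c b)
    (f : X → Y) (r D : ℝ) (hr : 0 < r) (hD : 1 ≤ D)
    (hemb : ∀ x y, r * d x y ≤ ρ (f x) (f y) ∧ ρ (f x) (f y) ≤ D * r * d x y) :
    lam' / lam < D := by
  have hpq : 0 < d p q :=
    pos_of_mul_pos_right ((add_nonneg (hd0 p s) (hd0 s q)).trans_lt hviol) hlam.le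
  have hDr : 0 < D * r := mul_pos (zero_lt_one.trans_le hD) hr
  have key : lam' * (r * d p q) < D * lam * (r * d p q) :=
    calc lam' * (r * d p q) ≤ lam' * ρ (f p) (f q) :=
          mul_le_mul_of_nonneg_left (hemb p q).1 hlam'.le
      _ ≤ ρ (f p) (f s) + ρ (f s) (f q) := hρtri _ _ _
      _ ≤ D * r * d p s + D * r * d s q := add_le_add (hemb p s).2 (hemb s q).2
      _ = D * r * (d p s + d s q) := by ring
      _ < D * r * (lam * d p q) := mul_lt_mul_of_pos_left hviol hDr
      _ = D * lam * (r * d p q) := by ring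
  exact (div_lt_iff₀ hlam).2 (lt_of_mul_lt_mul_right key (mul_pos hr hpq).le)
end

section
/- Let d ≥ 3 and 0 < β < 1/d, and define the d-dimensional histograms P = (1−(d−1)β, β, …, β), Q = (1/d, …, 1/d), and R = (β, 1−(d−1)β, β, …, β), equipped with the Bhattacharyya distance BD. Then for any metric space (Y,ρ), any map f of {P,Q,R} into Y, and any constants r > 0, D ≥ 1 with r·BD(x,y) ≤ ρ(f(x),f(y)) ≤ D·r·BD(x,y) for all x,y ∈ {P,Q,R}, the distortion satisfies D ≥ ln(1/((d−2)β + 2√(β(1−(d−1)β)))) / (2·ln(√d/(√(1−(d−1)β) + (d−1)√β))). -/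
/-- The Bhattacharyya distance between two `d`-dimensional histograms. -/
noncomputable def BD {d : ℕ} (P Q : Fin d → ℝ) : ℝ :=
  -Real.log (∑ i, Real.sqrt (P i * Q i))

/-- A sum over `Fin d` of a function constant off the first two indices. -/
theorem Fin.sum_eq_of_const_off_zero_one {d : ℕ} (hd : 2 ≤ d) (g : Fin d → ℝ) (x y z : ℝ)
    (hx : ∀ i : Fin d, (i : ℕ) = 0 → g i = x) (hy : ∀ i : Fin d, (i : ℕ) = 1 → g i = y)
    (hz : ∀ i : Fin d, (i : ℕ) ≠ 0 → (i : ℕ) ≠ 1 → g i = z) :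
    ∑ i, g i = x + y + ((d : ℝ) - 2) * z := by
  obtain ⟨n, rfl⟩ := Nat.exists_eq_add_of_le' hd
  rw [Fin.sum_univ_succ, Fin.sum_univ_succ, hx 0 rfl, hy (Fin.succ 0) rfl,
    Finset.sum_congr rfl fun i _ => hz i.succ.succ (by simp) (by simp)]
  simp
  ring

/-- Under a map with lower constant `r` and upper constant `D * r`, a distance function obeys the
triangle inequality up to the factor `D`. -/
theorem le_distortion_mul_add {X Y : Type*} [PseudoMetricSpace Y] (f : X → Y) {δ : X → X → ℝ}
    {r D : ℝ} (hr : 0 < r) {p q s : X} (hps : r * δ p s ≤ dist (f p) (f s))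
    (hpq : dist (f p) (f q) ≤ D * r * δ p q) (hqs : dist (f q) (f s) ≤ D * r * δ q s) :
    δ p s ≤ D * (δ p q + δ q s) := by
  refine le_of_mul_le_mul_left ?_ hr
  linarith [dist_triangle (f p) (f q) (f s)]

/-- For `d ≥ 3` and `0 < β < 1/d`, the histograms
`P = (1-(d-1)β, β, …, β)`, `Q = (1/d, …, 1/d)`, `R = (β, 1-(d-1)β, β, …, β)` under the
Bhattacharyya distance are such that any embedding of `{P, Q, R}` into a metric space
with constants `r > 0`, `D ≥ 1` must have
`D ≥ ln(1/((d-2)β + 2√(β(1-(d-1)β)))) / (2 ln(√d/(√(1-(d-1)β) + (d-1)√β)))`. -/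
theorem bhattacharyya_metric_embedding_lower_bound
    (d : ℕ) (hd : 3 ≤ d) (β : ℝ) (hβ : 0 < β) (hβd : β < 1 / d)
    (P Q R : Fin d → ℝ)
    (hP : P = fun (i : Fin d) => if (i : ℕ) = 0 then 1 - ((d : ℝ) - 1) * β else β)
    (hQ : Q = fun _ => 1 / (d : ℝ))
    (hR : R = fun (i : Fin d) => if (i : ℕ) = 1 then 1 - ((d : ℝ) - 1) * β else β)
    {Y : Type*} [MetricSpace Y] (f : (Fin d → ℝ) → Y)
    (r D : ℝ) (hr : 0 < r) (hD : 1 ≤ D)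
    (hemb : ∀ x ∈ ({P, Q, R} : Set (Fin d → ℝ)), ∀ y ∈ ({P, Q, R} : Set (Fin d → ℝ)),
      r * BD x y ≤ dist (f x) (f y) ∧ dist (f x) (f y) ≤ D * r * BD x y) :
    Real.log (1 / (((d : ℝ) - 2) * β + 2 * Real.sqrt (β * (1 - ((d : ℝ) - 1) * β))))
      / (2 * Real.log (Real.sqrt d /
          (Real.sqrt (1 - ((d : ℝ) - 1) * β) + ((d : ℝ) - 1) * Real.sqrt β)))
      ≤ D := by
  have hd0 : (0 : ℝ) < d := by
    exact_mod_cast (by omega : 0 < d)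
  have ha : 0 < 1 - ((d : ℝ) - 1) * β := by
    rw [lt_div_iff₀ hd0] at hβd
    linarith
  have hPR : BD P R = Real.log (1 / (((d : ℝ) - 2) * β +
      2 * Real.sqrt (β * (1 - ((d : ℝ) - 1) * β)))) := by
    rw [one_div, Real.log_inv, BD, Fin.sum_eq_of_const_off_zero_one (by omega) _
      (Real.sqrt (β * (1 - ((d : ℝ) - 1) * β))) (Real.sqrt (β * (1 - ((d : ℝ) - 1) * β))) β]
    · congr 2
      ring
    · intro i hi
      simp [hP, hR, hi, mul_comm]
    · intro i hi
      simp [hP, hR, hi]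
    · intro i hi hi'
      simp [hP, hR, hi, hi', hβ.le]
  have hPQ : BD P Q = Real.log (Real.sqrt d /
      (Real.sqrt (1 - ((d : ℝ) - 1) * β) + ((d : ℝ) - 1) * Real.sqrt β)) := by
    rw [← inv_div, Real.log_inv, BD, Fin.sum_eq_of_const_off_zero_one (by omega) _
      (Real.sqrt (1 - ((d : ℝ) - 1) * β) / Real.sqrt d) (Real.sqrt β / Real.sqrt d)
      (Real.sqrt β / Real.sqrt d)]
    · congr 2
      ring
    · intro i hi
      simp [hP, hQ, hi, Real.sqrt_mul ha.le, div_eq_mul_inv]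
    · intro i hi
      simp [hP, hQ, hi, Real.sqrt_mul hβ.le, div_eq_mul_inv]
    · intro i hi hi'
      simp [hP, hQ, hi, Real.sqrt_mul hβ.le, div_eq_mul_inv]
  have hQR : BD Q R = Real.log (Real.sqrt d /
      (Real.sqrt (1 - ((d : ℝ) - 1) * β) + ((d : ℝ) - 1) * Real.sqrt β)) := by
    rw [← inv_div, Real.log_inv, BD, Fin.sum_eq_of_const_off_zero_one (by omega) _
      (Real.sqrt β / Real.sqrt d) (Real.sqrt (1 - ((d : ℝ) - 1) * β) / Real.sqrt d)
      (Real.sqrt β / Real.sqrt d)]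
    · congr 2
      ring
    · intro i hi
      simp [hR, hQ, hi, div_eq_mul_inv, mul_comm]
    · intro i hi
      simp [hR, hQ, hi, div_eq_mul_inv, mul_comm]
    · intro i hi hi'
      simp [hR, hQ, hi', div_eq_mul_inv, mul_comm]
  have hub := (hemb P (by simp) Q (by simp)).2
  have hPQ_nonneg : 0 ≤ BD P Q :=
    nonneg_of_mul_nonneg_right (dist_nonneg.trans hub) (by positivity)
  have key := le_distortion_mul_add f hr (hemb P (by simp) R (by simp)).1 hub
    (hemb Q (by simp) R (by simp)).2
  rw [hQR, ← hPQ, ← two_mul] at key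
  rw [← hPR, ← hPQ]
  exact div_le_of_le_mul₀ (by positivity) (by positivity) key
end

section
/- Let d ≥ 2 and 0 < β < 1/(2d), and let P, Q be d-dimensional β-constrained histograms (pᵢ ≥ β and qᵢ ≥ β for all i). Then H(P,Q) ≤ BD(P,Q) ≤ (d/(1−2βd))·ln(1/((d−1)β))·H(P,Q). -/
/-- The chord bound for the concave function `log` on `[m, 1]`. -/
theorem neg_log_mul_one_sub_le {m x : ℝ} (hm : 0 < m) (hm1 : m < 1) (hmx : m ≤ x) (hx1 : x ≤ 1) :
    -Real.log x * (1 - m) ≤ -Real.log m * (1 - x) := by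
  have h1m : 0 < 1 - m := sub_pos.2 hm1
  have h := strictConcaveOn_log_Ioi.concaveOn.2 (Set.mem_Ioi.2 hm) (Set.mem_Ioi.2 one_pos)
    (div_nonneg (sub_nonneg.2 hx1) h1m.le) (div_nonneg (sub_nonneg.2 hmx) h1m.le)
    (by field_simp; ring)
  have hx : (1 - x) / (1 - m) * m + (x - m) / (1 - m) * 1 = x := by field_simp; ring
  simp only [smul_eq_mul, hx, Real.log_one, mul_zero, add_zero] at h
  rw [div_mul_eq_mul_div, div_le_iff₀ h1m] at h
  linarith

/-- The Bhattacharyya coefficient of two histograms is at most one. -/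
theorem sum_sqrt_mul_le_one {ι : Type*} [Fintype ι] {P Q : ι → ℝ}
    (hP0 : ∀ i, 0 ≤ P i) (hQ0 : ∀ i, 0 ≤ Q i) (hP1 : ∑ i, P i = 1) (hQ1 : ∑ i, Q i = 1) :
    ∑ i, Real.sqrt (P i * Q i) ≤ 1 := by
  have h := Real.sum_sqrt_mul_sqrt_le Finset.univ hP0 hQ0
  simpa [hP1, hQ1, Real.sqrt_mul (hP0 _)] using h

/-- The Bhattacharyya coefficient of two `β`-constrained histograms is at least `dβ`. -/
theorem card_mul_le_sum_sqrt_mul {ι : Type*} [Fintype ι] {P Q : ι → ℝ} {β : ℝ} (hβ : 0 ≤ β)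
    (hP : ∀ i, β ≤ P i) (hQ : ∀ i, β ≤ Q i) :
    Fintype.card ι * β ≤ ∑ i, Real.sqrt (P i * Q i) := by
  have h : ∑ _i : ι, β ≤ ∑ i, Real.sqrt (P i * Q i) :=
    Finset.sum_le_sum fun i _ => Real.le_sqrt_of_sq_le <| by
      rw [sq]; exact mul_le_mul (hP i) (hQ i) hβ (hβ.trans (hP i))
  simpa using h

/-- For `d ≥ 2`, `0 < β < 1/(2d)`, and `β`-constrained histograms `P`, `Q`
(every entry at least `β`), the Hellinger distance `H(P,Q) = 1 - ∑ i, √(pᵢ qᵢ)` and the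
Bhattacharyya distance `BD(P,Q) = -ln(∑ i, √(pᵢ qᵢ))` satisfy
`H(P,Q) ≤ BD(P,Q) ≤ (d/(1-2βd))·ln(1/((d-1)β))·H(P,Q)`. -/
theorem bhattacharyya_hellinger_distortion
    (d : ℕ) (hd : 2 ≤ d) (β : ℝ) (hβ : 0 < β) (hβd : β < 1 / (2 * d))
    (P Q : Fin d → ℝ)
    (hP0 : ∀ i, 0 ≤ P i) (hQ0 : ∀ i, 0 ≤ Q i)
    (hP1 : ∑ i, P i = 1) (hQ1 : ∑ i, Q i = 1)
    (hPc : ∀ i, β ≤ P i) (hQc : ∀ i, β ≤ Q i) :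
    (1 - ∑ i, Real.sqrt (P i * Q i) ≤ -Real.log (∑ i, Real.sqrt (P i * Q i))) ∧
    (-Real.log (∑ i, Real.sqrt (P i * Q i))
        ≤ ((d : ℝ) / (1 - 2 * β * d)) * Real.log (1 / (((d : ℝ) - 1) * β))
            * (1 - ∑ i, Real.sqrt (P i * Q i))) := by
  have hd2 : (2 : ℝ) ≤ d := by exact_mod_cast hd
  have hmpos : 0 < (d : ℝ) * β := by positivity
  have hm_half : (d : ℝ) * β < 1 / 2 := by
    rw [lt_div_iff₀ (by positivity)] at hβd
    linarith
  have hmx : (d : ℝ) * β ≤ ∑ i, Real.sqrt (P i * Q i) := by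
    simpa using card_mul_le_sum_sqrt_mul hβ.le hPc hQc
  have hx1 := sum_sqrt_mul_le_one hP0 hQ0 hP1 hQ1
  generalize ∑ i, Real.sqrt (P i * Q i) = x at hmx hx1 ⊢
  refine ⟨by linarith [Real.log_le_sub_one_of_pos (hmpos.trans_le hmx)], ?_⟩
  have hchord := neg_log_mul_one_sub_le hmpos (by linarith) hmx hx1
  have hlog : -Real.log (d * β) ≤ Real.log (1 / (((d : ℝ) - 1) * β)) := by
    rw [one_div, Real.log_inv]
    exact neg_le_neg (Real.log_le_log (mul_pos (by linarith) hβ) (by linarith))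
  have hlog0 : 0 ≤ -Real.log (d * β) :=
    neg_nonneg.2 (Real.log_nonpos hmpos.le (by linarith))
  have hfactor : 1 / (1 - d * β) ≤ (d : ℝ) / (1 - 2 * β * d) := by
    rw [div_le_div_iff₀ (by linarith) (by linarith)]
    nlinarith
  calc -Real.log x ≤ 1 / (1 - d * β) * -Real.log (d * β) * (1 - x) := by
        rw [mul_assoc, one_div_mul_eq_div, le_div_iff₀ (by linarith)]
        exact hchord
    _ ≤ _ := mul_le_mul_of_nonneg_right
        (mul_le_mul hfactor hlog hlog0 (div_nonneg (by linarith) (by linarith)))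
        (by linarith)
end

section
/- Let X be a set with a distance function d : X × X → ℝ≥0 such that d(x,y) ≤ M for all x,y ∈ X, and suppose there exist points p, q ∈ X with |d(p,q) − d(q,p)| > γ for some γ ≥ 0 (so d violates γ-relaxed symmetry). Then for any metric space (Y,ρ), any map f : X → Y, and any constants r > 0, D ≥ 1 satisfying r·d(x,y) ≤ ρ(f(x),f(y)) ≤ D·r·d(x,y) for all x,y ∈ X, we must have D > 1 + γ/M. -/
/-- An embedding into a metric space with distortion `D` bounds the ratio of `d x y` to
`d y x` by `D`. -/
theorem le_distortion_mul_swap {X Y : Type*} [MetricSpace Y] {d : X → X → ℝ} {f : X → Y}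
    {r D : ℝ} (hr : 0 < r)
    (hemb : ∀ x y, r * d x y ≤ dist (f x) (f y) ∧ dist (f x) (f y) ≤ D * r * d x y)
    (x y : X) : d x y ≤ D * d y x := by
  have hle : r * d x y ≤ D * r * d y x :=
    (hemb x y).1.trans ((dist_comm (f x) (f y)).trans_le (hemb y x).2)
  exact le_of_mul_le_mul_left (by linarith) hr

/-- If a distance function `d` on `X` is bounded by `M` and violates
`γ`-relaxed symmetry at some pair `p, q` (i.e. `|d p q - d q p| > γ` with `γ ≥ 0`),
then any embedding `f` of `(X, d)` into a metric space `(Y, ρ)` with constants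
`r > 0`, `D ≥ 1` satisfying `r·d x y ≤ ρ (f x) (f y) ≤ D·r·d x y` for all `x, y`
must have `D > 1 + γ/M`. -/
theorem relaxed_symmetry_lower_bound
    {X : Type*} (d : X → X → ℝ) (hd0 : ∀ x y, 0 ≤ d x y)
    (M : ℝ) (hM : ∀ x y, d x y ≤ M)
    (γ : ℝ) (hγ : 0 ≤ γ) (p q : X) (hviol : γ < |d p q - d q p|)
    {Y : Type*} [MetricSpace Y] (f : X → Y)
    (r D : ℝ) (hr : 0 < r) (hD : 1 ≤ D)
    (hemb : ∀ x y, r * d x y ≤ dist (f x) (f y) ∧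
      dist (f x) (f y) ≤ D * r * d x y) :
    1 + γ / M < D := by
  have hM_pos : 0 < M := by
    rcases lt_abs.1 hviol with h | h
    · linarith [hM p q, hd0 q p]
    · linarith [hM q p, hd0 p q]
  have hmul : γ < (D - 1) * M := by
    have hD' : 0 ≤ D - 1 := sub_nonneg.2 hD
    rcases lt_abs.1 hviol with h | h
    · linarith [le_distortion_mul_swap hr hemb p q,
        mul_le_mul_of_nonneg_left (hM q p) hD']
    · linarith [le_distortion_mul_swap hr hemb q p,
        mul_le_mul_of_nonneg_left (hM p q) hD']
  linarith [(div_lt_iff₀ hM_pos).2 hmul]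
end

section
/- Let d ≥ 3 and 0 < β ≤ 1/d⁴, and define the d-dimensional histograms P = (1/d, …, 1/d) and Q = (1−(d−1)β, β, …, β). Then KL(P,Q) − KL(Q,P) ≥ (1/2)·ln(1/(β·d⁴)). -/
/-- The Kullback-Leibler divergence between two `d`-dimensional histograms. -/
noncomputable def KL {d : ℕ} (P Q : Fin d → ℝ) : ℝ :=
  ∑ i, P i * Real.log (P i / Q i)

/-- For `d ≥ 3` and `0 < β ≤ 1/d⁴`, with `P = (1/d, …, 1/d)` uniform and
`Q = (1-(d-1)β, β, …, β)`, the asymmetry of the Kullback-Leibler divergence satisfies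
`KL(P,Q) - KL(Q,P) ≥ (1/2)·ln(1/(βd⁴))`. -/
theorem kl_asymmetry_gap
    (d : ℕ) (hd : 3 ≤ d) (β : ℝ) (hβ : 0 < β) (hβd : β ≤ 1 / (d : ℝ) ^ 4)
    (P Q : Fin d → ℝ)
    (hP : P = fun _ => 1 / (d : ℝ))
    (hQ : Q = fun (i : Fin d) => if (i : ℕ) = 0 then 1 - ((d : ℝ) - 1) * β else β) :
    (1 / 2) * Real.log (1 / (β * (d : ℝ) ^ 4)) ≤ KL P Q - KL Q P := by
  obtain ⟨m, rfl⟩ : ∃ m, d = m + 1 := ⟨d - 1, by omega⟩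
  have hm : (2 : ℝ) ≤ m := by exact_mod_cast (by omega : 2 ≤ m)
  subst hP hQ
  push_cast at hβd ⊢
  have hβ4 : β * ((m : ℝ) + 1) ^ 4 ≤ 1 := (le_div_iff₀ (by positivity)).1 hβd
  have hmβ : (m : ℝ) * β < 1 := by
    have hpow : (m : ℝ) + 1 ≤ ((m : ℝ) + 1) ^ 4 := le_self_pow₀ (by linarith) (by norm_num)
    nlinarith
  have hq : 0 < 1 - (m : ℝ) * β := by linarith
  have hn : (0 : ℝ) < (m : ℝ) + 1 := by linarith
  have hlogβ : Real.log β ≤ 0 := Real.log_nonpos hβ.le (by nlinarith)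
  have hlogq : Real.log (1 - m * β) ≤ 0 := Real.log_nonpos hq.le (by nlinarith)
  simp only [KL, Fin.sum_univ_succ, Fin.val_zero, Fin.val_succ, if_true, Nat.succ_ne_zero,
    if_false, Finset.sum_const, Finset.card_univ, Fintype.card_fin, nsmul_eq_mul,
    add_sub_cancel_right]
  rw [Real.log_div (by positivity) hq.ne', Real.log_div (by positivity) hβ.ne',
    Real.log_div hq.ne' (by positivity), Real.log_div hβ.ne' (by positivity),
    one_div (β * _), Real.log_inv, Real.log_mul hβ.ne' (by positivity), Real.log_pow,
    one_div ((m : ℝ) + 1), Real.log_inv]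
  have hinv : ((m : ℝ) + 1)⁻¹ ≤ 1 / 2 := by
    rw [inv_le_comm₀ hn (by norm_num)]
    linarith
  have hm_inv : (m : ℝ) * ((m : ℝ) + 1)⁻¹ = 1 - ((m : ℝ) + 1)⁻¹ := by
    field_simp
    ring
  have hcoefβ : 0 ≤ (1 / 2 - ((m : ℝ) + 1)⁻¹ + m * β) * -Real.log β :=
    mul_nonneg (by nlinarith) (by linarith)
  have hcoefq : 0 ≤ (((m : ℝ) + 1)⁻¹ + (1 - m * β)) * -Real.log (1 - m * β) :=
    mul_nonneg (by positivity) (by linarith)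
  push_cast
  linear_combination hcoefβ + hcoefq + (Real.log β + Real.log ((m : ℝ) + 1)) * hm_inv
end

section
/- Let d ≥ 3 and 0 < β < 1/d⁴, and let S be a set of d-dimensional β-constrained histograms that contains P = (1/d, …, 1/d) and Q = (1−(d−1)β, β, …, β). Then for any metric space (Y,ρ), any map f : S → Y, and any constants r > 0, D ≥ 1 satisfying r·KL(x,y) ≤ ρ(f(x),f(y)) ≤ D·r·KL(x,y) for all x,y ∈ S, we must have D ≥ 1 + ln(1/(β·d⁴))/(2·ln(1/β)). -/
/-- The divergence of a positive histogram from the uniform one is at most `log d`. -/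
lemma KL_uniform_right_le_log {d : ℕ} (hd : 1 ≤ d) {Q : Fin d → ℝ}
    (hQ : ∀ i, 0 < Q i) (hsum : ∑ i, Q i = 1) :
    KL Q (fun _ => 1 / (d : ℝ)) ≤ Real.log d := by
  have hd0 : (0 : ℝ) < d := by exact_mod_cast hd
  calc ∑ i, Q i * Real.log (Q i / (1 / (d : ℝ)))
      ≤ ∑ i, Q i * Real.log d := by
        refine Finset.sum_le_sum fun i _ => mul_le_mul_of_nonneg_left ?_ (hQ i).le
        have hi : Q i ≤ 1 :=
          hsum ▸ Finset.single_le_sum (fun j _ => (hQ j).le) (Finset.mem_univ i)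
        refine Real.log_le_log (div_pos (hQ i) (by positivity)) ?_
        rw [div_div_eq_mul_div, div_one]
        exact mul_le_of_le_one_left hd0.le hi
    _ = Real.log d := by rw [← Finset.sum_mul, hsum, one_mul]

/-- Lower bound on the divergence of the uniform histogram from one which equals `β` at every
coordinate but the first. -/
lemma le_KL_uniform_left {n : ℕ} {β : ℝ} {Q : Fin (n + 1) → ℝ}
    (hβ : 0 < β) (hQ0 : 0 < Q 0) (hQ1 : Q 0 ≤ 1) (hQ : ∀ i : Fin n, Q i.succ = β) :
    (n : ℝ) / (n + 1) * Real.log (1 / β) - Real.log (n + 1) ≤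
      KL (fun _ => 1 / ((n + 1 : ℕ) : ℝ)) Q := by
  have hn : (0 : ℝ) < n + 1 := by positivity
  have hlog0 := Real.log_nonpos hQ0.le hQ1
  simp only [KL, Fin.sum_univ_succ, hQ, Finset.sum_const, Finset.card_univ, Fintype.card_fin,
    nsmul_eq_mul, Nat.cast_add, Nat.cast_one]
  rw [one_div, one_div, Real.log_div (by positivity) hQ0.ne',
    Real.log_div (by positivity) hβ.ne', Real.log_inv, Real.log_inv]
  have h : ((n : ℝ) + 1)⁻¹ * Real.log (Q 0) ≤ 0 :=
    mul_nonpos_of_nonneg_of_nonpos (by positivity) hlog0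
  have hsplit : Real.log ((n : ℝ) + 1) =
      ((n : ℝ) + 1)⁻¹ * Real.log (n + 1) + n * (((n : ℝ) + 1)⁻¹ * Real.log (n + 1)) := by
    field_simp
    ring
  rw [div_eq_mul_inv]
  linarith

/-- For `d ≥ 3` and `0 < β < 1/d⁴`, let `S` be a set of `d`-dimensional
`β`-constrained histograms containing the uniform distribution `P = (1/d, …, 1/d)` and
`Q = (1-(d-1)β, β, …, β)`. Then any embedding `f` of `S` under the Kullback-Leibler
divergence into a metric space with constants `r > 0`, `D ≥ 1` must have
`D ≥ 1 + ln(1/(βd⁴))/(2·ln(1/β))`. -/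
theorem kl_metric_embedding_asymmetry_lower_bound
    (d : ℕ) (hd : 3 ≤ d) (β : ℝ) (hβ : 0 < β) (hβd : β < 1 / (d : ℝ) ^ 4)
    (S : Set (Fin d → ℝ))
    (hS : ∀ x ∈ S, (∀ i, β ≤ x i) ∧ ∑ i, x i = 1)
    (P Q : Fin d → ℝ)
    (hP : P = fun _ => 1 / (d : ℝ))
    (hQ : Q = fun (i : Fin d) => if (i : ℕ) = 0 then 1 - ((d : ℝ) - 1) * β else β)
    (hPS : P ∈ S) (hQS : Q ∈ S)
    {Y : Type*} [MetricSpace Y] (f : (Fin d → ℝ) → Y)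
    (r D : ℝ) (hr : 0 < r) (hD : 1 ≤ D)
    (hemb : ∀ x ∈ S, ∀ y ∈ S,
      r * KL x y ≤ dist (f x) (f y) ∧ dist (f x) (f y) ≤ D * r * KL x y) :
    1 + Real.log (1 / (β * (d : ℝ) ^ 4)) / (2 * Real.log (1 / β)) ≤ D := by
  obtain ⟨n, rfl⟩ : ∃ n, d = n + 1 := ⟨d - 1, by omega⟩
  have hQpos : ∀ i, 0 < Q i := fun i => hβ.trans_le ((hS Q hQS).1 i)
  have hQsum := (hS Q hQS).2
  have hQ1 : Q 0 ≤ 1 :=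
    hQsum ▸ Finset.single_le_sum (fun j _ => (hQpos j).le) (Finset.mem_univ 0)
  have hA := le_KL_uniform_left hβ (hQpos 0) hQ1 (fun i => by simp [hQ])
  have hB := KL_uniform_right_le_log (by omega) hQpos hQsum
  rw [← hP] at hA hB
  have hDB : KL P Q ≤ D * KL Q P := by
    have h1 := (hemb P hPS Q hQS).1
    have h2 := (hemb Q hQS P hPS).2
    rw [dist_comm] at h2
    exact le_of_mul_le_mul_left (by linarith) hr
  have hn : (2 : ℝ) ≤ n := by exact_mod_cast (by omega : 2 ≤ n)
  push_cast at hB hβd ⊢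
  have hl : 0 < Real.log ((n : ℝ) + 1) := Real.log_pos (by linarith)
  have hlogβ : Real.log (1 / (β * ((n : ℝ) + 1) ^ 4)) =
      Real.log (1 / β) - 4 * Real.log ((n : ℝ) + 1) := by
    rw [one_div, one_div, Real.log_inv, Real.log_inv,
      Real.log_mul hβ.ne' (by positivity), Real.log_pow]
    push_cast
    ring
  have hpos : 0 < Real.log (1 / (β * ((n : ℝ) + 1) ^ 4)) := by
    refine Real.log_pos ?_
    rw [lt_div_iff₀ (by positivity), one_mul]
    exact (lt_div_iff₀ (by positivity)).1 hβd
  rw [hlogβ] at hpos ⊢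
  generalize Real.log (1 / β) = L at *
  generalize Real.log ((n : ℝ) + 1) = l at *
  have hL : 0 < L := by linarith
  have hhalf : L / 2 ≤ (n : ℝ) / (n + 1) * L := by
    have : (1 : ℝ) / 2 ≤ n / (n + 1) := by
      rw [div_le_div_iff₀ (by norm_num) (by positivity)]
      linarith
    nlinarith
  have hDl : D * KL Q P ≤ D * l := mul_le_mul_of_nonneg_left hB (by linarith)
  have hquot : (L - 4 * l) / (2 * L) ≤ (L - 4 * l) / (2 * l) :=
    div_le_div_of_nonneg_left hpos.le (by positivity) (by linarith)
  have hbound : (L - 4 * l) / (2 * l) ≤ D - 1 := by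
    rw [div_le_iff₀ (by positivity)]
    linarith
  linarith
end

section
/- Let d ≥ 2 and let c, ε be reals with 1/d ≥ ε > e^{−c} > 0. Define the d-dimensional histograms P = (1/d, …, 1/d), Q = (1−(d−1)ε, ε, …, ε), and R = (1−(d−1)e^{−c}, e^{−c}, …, e^{−c}). Then KL(P,Q) ≤ ln(1/(dε)), KL(Q,R) ≤ (d−1)·ε·(c + ln ε), and KL(P,R) ≥ (1/2)·(c − ln d) − (ln d)/d. -/
/-- The divergence of two histograms that are constant away from the first coordinate. -/
theorem KL_eq_of_const_off_zero {d : ℕ} (hd : 1 ≤ d) (a b a' b' : ℝ) :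
    KL (fun i : Fin d => if (i : ℕ) = 0 then a else b)
        (fun i : Fin d => if (i : ℕ) = 0 then a' else b') =
      a * Real.log (a / a') + ((d : ℝ) - 1) * (b * Real.log (b / b')) := by
  obtain ⟨n, rfl⟩ := Nat.exists_eq_add_of_le' hd
  simp [KL, Fin.sum_univ_succ]

/-- For `d ≥ 2` and reals `c`, `ε` with `1/d ≥ ε > e^{-c} > 0`, the
histograms `P = (1/d, …, 1/d)`, `Q = (1-(d-1)ε, ε, …, ε)`,
`R = (1-(d-1)e^{-c}, e^{-c}, …, e^{-c})` satisfy `KL(P,Q) ≤ ln(1/(dε))`,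
`KL(Q,R) ≤ (d-1)·ε·(c + ln ε)`, and `KL(P,R) ≥ (1/2)(c - ln d) - (ln d)/d`. -/
theorem kl_three_point_estimates
    (d : ℕ) (hd : 2 ≤ d) (c ε : ℝ)
    (hε : ε ≤ 1 / (d : ℝ)) (hεc : Real.exp (-c) < ε) (hc : 0 < Real.exp (-c))
    (P Q R : Fin d → ℝ)
    (hP : P = fun _ => 1 / (d : ℝ))
    (hQ : Q = fun (i : Fin d) => if (i : ℕ) = 0 then 1 - ((d : ℝ) - 1) * ε else ε)
    (hR : R = fun (i : Fin d) =>
      if (i : ℕ) = 0 then 1 - ((d : ℝ) - 1) * Real.exp (-c) else Real.exp (-c)) :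
    KL P Q ≤ Real.log (1 / ((d : ℝ) * ε)) ∧
    KL Q R ≤ ((d : ℝ) - 1) * ε * (c + Real.log ε) ∧
    (1 / 2) * (c - Real.log d) - Real.log d / d ≤ KL P R := by
  have hd2 : (2 : ℝ) ≤ d := by exact_mod_cast hd
  have hd0 : (0 : ℝ) < d := by linarith
  have hε0 : 0 < ε := hc.trans hεc
  have hQ0 : 1 / (d : ℝ) ≤ 1 - ((d : ℝ) - 1) * ε := by
    have h : ((d : ℝ) - 1) * ε ≤ (d - 1) * (1 / d) :=
      mul_le_mul_of_nonneg_left hε (by linarith)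
    have h' : ((d : ℝ) - 1) * (1 / d) = 1 - 1 / d := by field_simp
    linarith
  have hd_inv : 0 < 1 / (d : ℝ) := by positivity
  have hQR : 1 - ((d : ℝ) - 1) * ε ≤ 1 - ((d : ℝ) - 1) * Real.exp (-c) := by
    have := mul_le_mul_of_nonneg_left hεc.le (by linarith : (0 : ℝ) ≤ (d : ℝ) - 1)
    linarith
  have hR1 : 1 - ((d : ℝ) - 1) * Real.exp (-c) ≤ 1 := by
    have := mul_nonneg (by linarith : (0 : ℝ) ≤ (d : ℝ) - 1) hc.le
    linarith
  have hP' : P = fun i : Fin d => if (i : ℕ) = 0 then 1 / (d : ℝ) else 1 / d := by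
    simp [hP]
  have hd1 : 1 ≤ d := by omega
  subst hP' hQ hR
  simp only [KL_eq_of_const_off_zero hd1]
  refine ⟨?_, ?_, ?_⟩
  · have hlog : Real.log (1 / (d : ℝ) / (1 - ((d : ℝ) - 1) * ε)) ≤
        Real.log (1 / ((d : ℝ) * ε)) := by
      rw [← div_div]
      exact Real.log_le_log (div_pos hd_inv (hd_inv.trans_le hQ0))
        (div_le_div_of_nonneg_left hd_inv.le hε0 (hε.trans hQ0))
    calc
      _ ≤ 1 / (d : ℝ) * Real.log (1 / ((d : ℝ) * ε)) +
          ((d : ℝ) - 1) * (1 / d * Real.log (1 / ((d : ℝ) * ε))) := by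
        rw [div_div 1 (d : ℝ) ε]
        gcongr
      _ = Real.log (1 / ((d : ℝ) * ε)) := by
        field_simp
        ring
  · have hlog : Real.log ((1 - ((d : ℝ) - 1) * ε) / (1 - ((d : ℝ) - 1) * Real.exp (-c))) ≤ 0 :=
      Real.log_nonpos (div_nonneg (by linarith) (by linarith))
        (div_le_one_of_le₀ hQR (by linarith))
    have hmul := mul_nonpos_of_nonneg_of_nonpos (hd_inv.le.trans hQ0) hlog
    rw [Real.log_div hε0.ne' hc.ne', Real.log_exp]
    linarith
  · have hlog : -Real.log d ≤
        Real.log (1 / (d : ℝ) / (1 - ((d : ℝ) - 1) * Real.exp (-c))) := by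
      rw [Real.log_div hd_inv.ne' (by linarith), one_div, Real.log_inv]
      have := Real.log_nonpos (by linarith) hR1
      linarith
    have hmul := mul_le_mul_of_nonneg_left hlog hd_inv.le
    have hcd : 0 ≤ c - Real.log d := by
      have := Real.log_le_log hc (hεc.le.trans hε)
      rw [Real.log_exp, one_div, Real.log_inv] at this
      linarith
    have hhalf : 1 / 2 ≤ ((d : ℝ) - 1) * (1 / d) := by
      rw [mul_one_div, le_div_iff₀ hd0]
      linarith
    have hmul' := mul_le_mul_of_nonneg_right hhalf hcd
    rw [Real.log_div hd_inv.ne' hc.ne', Real.log_exp, one_div (d : ℝ), Real.log_inv]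
    simp only [one_div] at hmul hmul' ⊢
    rw [div_eq_inv_mul]
    linarith
end

section
/- Let d ≥ 2 and let c, ε be reals with 1/d ≥ ε > e^{−c} > 0, and define the d-dimensional histograms P = (1/d, …, 1/d), Q = (1−(d−1)ε, ε, …, ε), and R = (1−(d−1)e^{−c}, e^{−c}, …, e^{−c}). Then for any metric space (Y,ρ), any map f of {P,Q,R} into Y, and any constants r > 0, D ≥ 1 satisfying r·KL(x,y) ≤ ρ(f(x),f(y)) ≤ D·r·KL(x,y) for all x,y ∈ {P,Q,R}, we must have D ≥ ((1/2)·(c − ln d) − (ln d)/d) / (ln(1/(dε)) + (d−1)·ε·(c + ln ε)). -/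
/-- The divergence between two histograms that are constant off the index `0`. -/
lemma KL_spike {d : ℕ} (hd : 0 < d) (a b a' b' : ℝ) :
    KL (fun i : Fin d => if (i : ℕ) = 0 then a else b)
        (fun i : Fin d => if (i : ℕ) = 0 then a' else b')
      = a * Real.log (a / a') + ((d : ℝ) - 1) * (b * Real.log (b / b')) := by
  obtain ⟨n, rfl⟩ := Nat.exists_eq_succ_of_ne_zero hd.ne'
  simp [KL, Fin.sum_univ_succ]

/-- A uniform upper bound for the divergence when the mass at `0` does not decrease. -/
lemma KL_spike_le {d : ℕ} (hd : 0 < d) {a b a' b' : ℝ} (ha : 0 ≤ a) (haa : a ≤ a') :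
    KL (fun i : Fin d => if (i : ℕ) = 0 then a else b)
        (fun i : Fin d => if (i : ℕ) = 0 then a' else b')
      ≤ ((d : ℝ) - 1) * (b * Real.log (b / b')) := by
  rw [KL_spike hd]
  have h : Real.log (a / a') ≤ 0 :=
    Real.log_nonpos (div_nonneg ha (ha.trans haa)) (div_le_one_of_le₀ haa (ha.trans haa))
  linarith [mul_nonpos_of_nonneg_of_nonpos ha h]

/-- For `d ≥ 2` and reals `c`, `ε` with `1/d ≥ ε > e^{-c} > 0`, and the
histograms `P = (1/d, …, 1/d)`, `Q = (1-(d-1)ε, ε, …, ε)`,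
`R = (1-(d-1)e^{-c}, e^{-c}, …, e^{-c})` under the Kullback-Leibler divergence, any
embedding of `{P, Q, R}` into a metric space with constants `r > 0`, `D ≥ 1` must have
`D ≥ ((1/2)(c - ln d) - (ln d)/d) / (ln(1/(dε)) + (d-1)·ε·(c + ln ε))`. -/
theorem kl_metric_embedding_triangle_lower_bound
    (d : ℕ) (hd : 2 ≤ d) (c ε : ℝ)
    (hε : ε ≤ 1 / (d : ℝ)) (hεc : Real.exp (-c) < ε) (hc : 0 < Real.exp (-c))
    (P Q R : Fin d → ℝ)
    (hP : P = fun _ => 1 / (d : ℝ))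
    (hQ : Q = fun (i : Fin d) => if (i : ℕ) = 0 then 1 - ((d : ℝ) - 1) * ε else ε)
    (hR : R = fun (i : Fin d) =>
      if (i : ℕ) = 0 then 1 - ((d : ℝ) - 1) * Real.exp (-c) else Real.exp (-c))
    {Y : Type*} [MetricSpace Y] (f : (Fin d → ℝ) → Y)
    (r D : ℝ) (hr : 0 < r) (hD : 1 ≤ D)
    (hemb : ∀ x ∈ ({P, Q, R} : Set (Fin d → ℝ)), ∀ y ∈ ({P, Q, R} : Set (Fin d → ℝ)),
      r * KL x y ≤ dist (f x) (f y) ∧ dist (f x) (f y) ≤ D * r * KL x y) :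
    ((1 / 2) * (c - Real.log d) - Real.log d / d)
        / (Real.log (1 / ((d : ℝ) * ε)) + ((d : ℝ) - 1) * ε * (c + Real.log ε))
      ≤ D := by
  have hd2 : (2 : ℝ) ≤ d := by exact_mod_cast hd
  have hd0 : 0 < d := by omega
  have hdpos : (0 : ℝ) < d := by linarith
  have hε0 : 0 < ε := hc.trans hεc
  have hdε : d * ε ≤ 1 := by
    rw [le_div_iff₀ hdpos] at hε
    linarith
  have hP' : P = fun i : Fin d => if (i : ℕ) = 0 then 1 / (d : ℝ) else 1 / d := by
    simp [hP]
  have hid : ((d : ℝ) - 1) * (1 / d) = 1 - 1 / d := by field_simp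
  have hinv : 0 < 1 / (d : ℝ) := by positivity
  have hinv2 : 1 / (d : ℝ) ≤ 1 / 2 := one_div_le_one_div_of_le two_pos hd2
  have hQ0 : 1 / (d : ℝ) ≤ 1 - ((d : ℝ) - 1) * ε := by nlinarith
  have hQR : 1 - ((d : ℝ) - 1) * ε ≤ 1 - ((d : ℝ) - 1) * Real.exp (-c) := by nlinarith
  have hlog0 : 0 ≤ Real.log (1 / (d * ε)) :=
    Real.log_nonneg (by rw [le_div_iff₀ (by positivity)]; linarith)
  have hcε : 0 < c + Real.log ε := by
    have := (Real.lt_log_iff_exp_lt hε0).2 hεc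
    linarith
  have hcd : Real.log d ≤ c := by
    have := Real.log_nonneg (one_le_one_div (by positivity) hdε)
    rw [one_div, Real.log_inv, Real.log_mul hdpos.ne' hε0.ne'] at this
    linarith
  have hPQle : KL P Q ≤ Real.log (1 / (d * ε)) := by
    rw [hP', hQ]
    refine (KL_spike_le hd0 hinv.le hQ0).trans ?_
    rw [← mul_assoc, hid, div_div]
    nlinarith
  have hQRle : KL Q R ≤ ((d : ℝ) - 1) * ε * (c + Real.log ε) := by
    rw [hQ, hR]
    refine (KL_spike_le hd0 (hinv.le.trans hQ0) hQR).trans_eq ?_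
    rw [Real.log_div hε0.ne' hc.ne', Real.log_exp]
    ring
  have hPRge : (1 / 2) * (c - Real.log d) - Real.log d / d ≤ KL P R := by
    rw [hP', hR, KL_spike hd0, ← mul_assoc, hid, Real.log_div hinv.ne' hc.ne', Real.log_exp,
      Real.log_div hinv.ne' (hinv.trans_le (hQ0.trans hQR)).ne', one_div (d : ℝ), Real.log_inv]
    have hl : Real.log (1 - ((d : ℝ) - 1) * Real.exp (-c)) ≤ 0 :=
      Real.log_nonpos (hinv.le.trans (hQ0.trans hQR)) (by nlinarith)
    rw [one_div] at hinv hinv2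
    rw [div_eq_mul_inv (Real.log d)]
    linarith [mul_nonneg hinv.le (neg_nonneg.2 hl),
      mul_nonneg (sub_nonneg.2 hinv2) (sub_nonneg.2 hcd)]
  have hden : 0 < Real.log (1 / (d * ε)) + ((d : ℝ) - 1) * ε * (c + Real.log ε) :=
    add_pos_of_nonneg_of_pos hlog0 (mul_pos (mul_pos (by linarith) hε0) hcε)
  have h1 := (hemb P (by simp) R (by simp)).1
  have h2 := (hemb P (by simp) Q (by simp)).2
  have h3 := (hemb Q (by simp) R (by simp)).2
  have htri := dist_triangle (f P) (f Q) (f R)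
  have hKL : KL P R ≤ D * (KL P Q + KL Q R) := by
    refine le_of_mul_le_mul_left ?_ hr
    linarith
  rw [div_le_iff₀ hden]
  exact hPRge.trans (hKL.trans
    (mul_le_mul_of_nonneg_left (add_le_add hPQle hQRle) (by linarith)))
end

section
/- Let 0 < β and let P = (p₁,…,p_d) and Q = (q₁,…,q_d) be d-dimensional β-constrained histograms (pᵢ ≥ β and qᵢ ≥ β for all i). Then KL(P,Q) ≤ (1/(2β) + 1/(3β⁵))·∑_{i=1}^d (pᵢ − qᵢ)². -/
/-- Summand-wise comparison of the Kullback-Leibler divergence with the chi-square divergence. -/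
theorem mul_log_div_le_sq_div_add_sub {p q : ℝ} (hp : 0 < p) (hq : 0 < q) :
    p * Real.log (p / q) ≤ (p - q) ^ 2 / q + (p - q) := by
  calc p * Real.log (p / q) ≤ p * (p / q - 1) :=
        mul_le_mul_of_nonneg_left (Real.log_le_sub_one_of_pos (div_pos hp hq)) hp.le
    _ = (p - q) ^ 2 / q + (p - q) := by
        field_simp
        ring

theorem KL_le_inv_mul_sum_sq {d : ℕ} {β : ℝ} (hβ : 0 < β) {P Q : Fin d → ℝ}
    (hPQ : ∑ i, P i = ∑ i, Q i) (hP : ∀ i, 0 < P i) (hQ : ∀ i, β ≤ Q i) :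
    KL P Q ≤ β⁻¹ * ∑ i, (P i - Q i) ^ 2 := by
  calc KL P Q ≤ ∑ i, (β⁻¹ * (P i - Q i) ^ 2 + (P i - Q i)) := by
        refine Finset.sum_le_sum fun i _ => ?_
        refine (mul_log_div_le_sq_div_add_sub (hP i) (hβ.trans_le (hQ i))).trans ?_
        rw [inv_mul_eq_div]
        gcongr
        exact hQ i
    _ = β⁻¹ * ∑ i, (P i - Q i) ^ 2 := by
        rw [Finset.sum_add_distrib, Finset.sum_sub_distrib, hPQ, sub_self, add_zero,
          Finset.mul_sum]

theorem inv_le_of_le_half {β : ℝ} (hβ : 0 < β) (h : β ≤ 1 / 2) :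
    β⁻¹ ≤ 1 / (2 * β) + 1 / (3 * β ^ 5) := by
  have h4 : β ^ 4 ≤ (1 / 2) ^ 4 := pow_le_pow_left₀ hβ.le h 4
  have key : 1 / (2 * β) ≤ 1 / (3 * β ^ 5) := by
    apply one_div_le_one_div_of_le (by positivity)
    nlinarith
  have hsum : β⁻¹ = 1 / (2 * β) + 1 / (2 * β) := by
    field_simp
    norm_num
  linarith

/-- For `β > 0` and `β`-constrained `d`-dimensional histograms `P`, `Q`
(every entry at least `β`), the Kullback-Leibler divergence is bounded above by a
multiple of the squared `l₂` distance:
`KL(P,Q) ≤ (1/(2β) + 1/(3β⁵))·∑ i, (pᵢ - qᵢ)²`. -/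
theorem kl_le_l2_sq
    (d : ℕ) (β : ℝ) (hβ : 0 < β)
    (P Q : Fin d → ℝ)
    (hP1 : ∑ i, P i = 1) (hQ1 : ∑ i, Q i = 1)
    (hPc : ∀ i, β ≤ P i) (hQc : ∀ i, β ≤ Q i) :
    KL P Q ≤ (1 / (2 * β) + 1 / (3 * β ^ 5)) * ∑ i, (P i - Q i) ^ 2 := by
  match d, P, Q, hP1, hQ1, hPc, hQc with
  | 0, P, Q, hP1, hQ1, hPc, hQc => simp at hP1
  | 1, P, Q, hP1, hQ1, hPc, hQc =>
    simp only [Fin.sum_univ_one] at hP1 hQ1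
    simp [KL, hP1, hQ1]
  | n + 2, P, Q, hP1, hQ1, hPc, hQc =>
    have hcard : ((n : ℝ) + 2) * β ≤ 1 := by
      have h := Finset.card_nsmul_le_sum Finset.univ P β fun i _ => hPc i
      simpa [hP1] using h
    have hn : 0 ≤ (n : ℝ) * β := by positivity
    refine (KL_le_inv_mul_sum_sq hβ (hP1.trans hQ1.symm)
      (fun i => hβ.trans_le (hPc i)) hQc).trans ?_
    exact mul_le_mul_of_nonneg_right (inv_le_of_le_half hβ (by linarith))
      (Finset.sum_nonneg fun i _ => sq_nonneg _)
end
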